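/- Let X ⊆ ℝ^n be convex, F monotone on X, and x* ∈ X a solution of VI_X(F) with x^1 ≠ x*. Fix p ≥ 1 real, L_p > 0, τ ∈ (0,1), N ≥ 1. Let x^k, x^{k+0.5}, x^{k+1} ∈ X (k = 1,…,N) be ARE iterates (conditions (i), (ii) and the approximation bound as in the ARE scheme) with γ_k := L_p‖x^{k+0.5} − x^k‖^{p−1} > 0 for all k. Then Γ_N := Σ_{k=1}^N γ_k^{−1} satisfies Γ_N ≥ (N^{(p+1)/2}/L_p) · ((1 − τ²)/‖x^1 − x*‖²)^{(p−1)/2}. -/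

import Mathlib

open scoped InnerProductSpace

theorem are_step_aux {E : Type*} [NormedAddCommGroup E] [InnerProductSpace ℝ E]
    (a h b s G Gt : E) (g τ : ℝ) (hg : 0 < g)
    (h0 : 0 ≤ ⟪G, h - s⟫_ℝ)
    (h1 : 0 ≤ ⟪Gt + g • (h - a), b - h⟫_ℝ)
    (h2 : 0 ≤ ⟪G + g • (b - a), s - b⟫_ℝ)
    (h3 : ‖Gt - G‖ ≤ τ * g * ‖h - a‖) :
    (1 - τ ^ 2) * ‖h - a‖ ^ 2 ≤ ‖a - s‖ ^ 2 - ‖b - s‖ ^ 2 := by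
  have h4 : ⟪Gt - G, b - h⟫_ℝ ≤ τ * g * ‖h - a‖ * ‖b - h‖ :=
    (real_inner_le_norm _ _).trans (mul_le_mul_of_nonneg_right h3 (norm_nonneg _))
  have e1 : ‖b - a‖ ^ 2 = ‖h - a‖ ^ 2 + 2 * ⟪h - a, b - h⟫_ℝ + ‖b - h‖ ^ 2 := by
    rw [← norm_add_sq_real]; congr 2; abel
  have e2 : ‖a - s‖ ^ 2 = ‖b - a‖ ^ 2 + 2 * ⟪b - a, s - b⟫_ℝ + ‖b - s‖ ^ 2 := by
    rw [norm_sub_rev b s, ← norm_add_sq_real, norm_sub_rev a s]; congr 2; abel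
  have e3 : ⟪G, s - b⟫_ℝ = - ⟪G, h - s⟫_ℝ - ⟪G, b - h⟫_ℝ := by
    rw [← inner_neg_right, ← inner_sub_right]; congr 1; abel
  rw [inner_add_left, real_inner_smul_left] at h1 h2
  rw [inner_sub_left] at h4
  have h5 : 0 ≤ g * (⟪h - a, b - h⟫_ℝ + ⟪b - a, s - b⟫_ℝ + τ * ‖h - a‖ * ‖b - h‖) := by
    nlinarith
  have h6 := nonneg_of_mul_nonneg_right h5 hg
  nlinarith [sq_nonneg (‖b - h‖ - τ * ‖h - a‖)]

theorem are_bern_aux (t q : ℝ) (ht : 0 < t) (hq : 0 ≤ q) :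
    1 - q * (t - 1) ≤ (t ^ q)⁻¹ := by
  rw [← Real.rpow_neg ht.le, Real.rpow_def_of_pos ht]
  have h1 := Real.add_one_le_exp (Real.log t * -q)
  have h2 := Real.log_le_sub_one_of_pos ht
  nlinarith

theorem are_term_aux (r w p : ℝ) (hr : 0 ≤ r) (hw : 0 < w) (hp : 1 ≤ p)
    (hpos : 0 < r ^ (p - 1)) :
    w ^ ((p - 1) / 2) * (1 - (p - 1) / 2 * (r ^ 2 * w - 1)) ≤ (r ^ (p - 1))⁻¹ := by
  rcases hp.eq_or_lt with rfl | hp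
  · simp
  have hr' : 0 < r := by
    rcases hr.eq_or_lt with rfl | h
    · rw [Real.zero_rpow (by linarith)] at hpos
      exact absurd hpos (lt_irrefl _)
    · exact h
  have hb := are_bern_aux (r ^ 2 * w) ((p - 1) / 2) (by positivity) (by linarith)
  have e : (r ^ 2 * w) ^ ((p - 1) / 2) = r ^ (p - 1) * w ^ ((p - 1) / 2) := by
    rw [Real.mul_rpow (by positivity) hw.le, ← Real.rpow_natCast r 2, ← Real.rpow_mul hr]
    congr 2
    push_cast; ring
  have hwq : 0 < w ^ ((p - 1) / 2) := Real.rpow_pos_of_pos hw _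
  calc _ ≤ w ^ ((p - 1) / 2) * ((r ^ 2 * w) ^ ((p - 1) / 2))⁻¹ :=
        mul_le_mul_of_nonneg_left hb hwq.le
    _ = _ := by rw [e]; field_simp

/-- Lower bound on `Γ_N` in the ARE complexity analysis. -/
theorem are_Gamma_lower_bound
    {n : ℕ} (X : Set (EuclideanSpace ℝ (Fin n))) (hX : Convex ℝ X)
    (F : EuclideanSpace ℝ (Fin n) → EuclideanSpace ℝ (Fin n))
    (hmono : ∀ x ∈ X, ∀ y ∈ X, 0 ≤ ⟪F x - F y, x - y⟫_ℝ)
    (xstar : EuclideanSpace ℝ (Fin n)) (hxstarX : xstar ∈ X)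
    (hxstar : ∀ x ∈ X, 0 ≤ ⟪F xstar, x - xstar⟫_ℝ)
    (p Lp τ : ℝ) (hp : 1 ≤ p) (hLp : 0 < Lp) (hτ0 : 0 < τ) (hτ1 : τ < 1)
    (N : ℕ) (hN : 1 ≤ N)
    (x xh : ℕ → EuclideanSpace ℝ (Fin n))
    (Ftil : ℕ → EuclideanSpace ℝ (Fin n) → EuclideanSpace ℝ (Fin n))
    (hxX : ∀ k ∈ Finset.Icc 1 (N + 1), x k ∈ X)
    (hxhX : ∀ k ∈ Finset.Icc 1 N, xh k ∈ X)
    (hx1 : x 1 ≠ xstar)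
    (γ : ℕ → ℝ) (hγ : ∀ k, γ k = Lp * ‖xh k - x k‖ ^ (p - 1))
    (hγpos : ∀ k ∈ Finset.Icc 1 N, 0 < γ k)
    (hstep1 : ∀ k ∈ Finset.Icc 1 N, ∀ z ∈ X,
      0 ≤ ⟪Ftil k (xh k) + γ k • (xh k - x k), z - xh k⟫_ℝ)
    (hstep2 : ∀ k ∈ Finset.Icc 1 N, ∀ z ∈ X,
      0 ≤ ⟪F (xh k) + γ k • (x (k + 1) - x k), z - x (k + 1)⟫_ℝ)
    (happrox : ∀ k ∈ Finset.Icc 1 N, ∀ z,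
      ‖Ftil k z - F z‖ ≤ τ * Lp * ‖z - x k‖ ^ p)
    (Γ : ℝ) (hΓ : Γ = ∑ k ∈ Finset.Icc 1 N, (γ k)⁻¹) :
    (N : ℝ) ^ ((p + 1) / 2) / Lp * ((1 - τ ^ 2) / ‖x 1 - xstar‖ ^ 2) ^ ((p - 1) / 2) ≤ Γ := by
  have hstep : ∀ k ∈ Finset.Icc 1 N,
      (1 - τ ^ 2) * ‖xh k - x k‖ ^ 2 ≤ ‖x k - xstar‖ ^ 2 - ‖x (k + 1) - xstar‖ ^ 2 := by
    intro k hk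
    have hk' := Finset.mem_Icc.1 hk
    refine are_step_aux (x k) (xh k) (x (k + 1)) xstar (F (xh k)) (Ftil k (xh k)) (γ k) τ
      (hγpos k hk) ?_ (hstep1 k hk _ (hxX _ (Finset.mem_Icc.2 ⟨by omega, by omega⟩)))
      (hstep2 k hk _ hxstarX) ?_
    · have h1 := hmono _ (hxhX k hk) _ hxstarX
      have h2 := hxstar _ (hxhX k hk)
      rw [inner_sub_left] at h1
      linarith
    · refine (happrox k hk (xh k)).trans ?_
      rw [hγ k]
      have : ‖xh k - x k‖ ^ p ≤ ‖xh k - x k‖ ^ (p - 1) * ‖xh k - x k‖ := by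
        rcases (norm_nonneg (xh k - x k)).eq_or_lt with h | h
        · rw [← h, Real.zero_rpow (by linarith)]; simp
        · rw [Real.rpow_sub_one h.ne']
          field_simp
          exact le_rfl
      have h3 : 0 ≤ τ * Lp := by positivity
      nlinarith [mul_le_mul_of_nonneg_left this h3]
  have htel : ∀ M : ℕ, M ≤ N → (1 - τ ^ 2) * ∑ k ∈ Finset.Icc 1 M, ‖xh k - x k‖ ^ 2
      ≤ ‖x 1 - xstar‖ ^ 2 - ‖x (M + 1) - xstar‖ ^ 2 := by
    intro M
    induction M with
    | zero => intro _; simp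
    | succ M ih =>
      intro hM
      rw [Finset.sum_Icc_succ_top (by omega), mul_add]
      have h1 := ih (by omega)
      have h2 := hstep (M + 1) (Finset.mem_Icc.2 ⟨by omega, hM⟩)
      linarith
  have hsum : (1 - τ ^ 2) * ∑ k ∈ Finset.Icc 1 N, ‖xh k - x k‖ ^ 2 ≤ ‖x 1 - xstar‖ ^ 2 := by
    have := htel N le_rfl
    nlinarith [sq_nonneg ‖x (N + 1) - xstar‖]
  have hD : 0 < ‖x 1 - xstar‖ := norm_pos_iff.2 (sub_ne_zero.2 hx1)
  have hτ2 : 0 < 1 - τ ^ 2 := by nlinarith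
  have hNpos : (0 : ℝ) < N := by exact_mod_cast hN
  set c : ℝ := (1 - τ ^ 2) / ‖x 1 - xstar‖ ^ 2 with hc
  have hcpos : 0 < c := by positivity
  set q : ℝ := (p - 1) / 2 with hq
  have hq0 : 0 ≤ q := by rw [hq]; linarith
  have hsum2 : (∑ k ∈ Finset.Icc 1 N, ‖xh k - x k‖ ^ 2) * (N * c) ≤ N := by
    have : (∑ k ∈ Finset.Icc 1 N, ‖xh k - x k‖ ^ 2) * c ≤ 1 := by
      rw [hc, ← mul_div_assoc, div_le_one (by positivity)]
      linarith
    nlinarith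
  have hterm : ∀ k ∈ Finset.Icc 1 N,
      Lp⁻¹ * ((N * c) ^ q * (1 - q * (‖xh k - x k‖ ^ 2 * (N * c) - 1))) ≤ (γ k)⁻¹ := by
    intro k hk
    have h := hγpos k hk
    rw [hγ k] at h ⊢
    rw [mul_inv]
    refine mul_le_mul_of_nonneg_left ?_ (by positivity)
    exact are_term_aux _ _ p (norm_nonneg _) (by positivity) hp (pos_of_mul_pos_right h hLp.le)
  rw [hΓ]
  refine le_trans ?_ (Finset.sum_le_sum hterm)
  rw [← Finset.mul_sum, ← Finset.mul_sum, Finset.sum_sub_distrib, ← Finset.mul_sum,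
    Finset.sum_sub_distrib, ← Finset.sum_mul]
  simp only [Finset.sum_const, Nat.card_Icc, Nat.add_sub_cancel, nsmul_eq_mul, mul_one]
  have e : (N : ℝ) ^ ((p + 1) / 2) / Lp * c ^ q = Lp⁻¹ * ((N * c) ^ q * N) := by
    rw [Real.mul_rpow hNpos.le hcpos.le]
    have : (p + 1) / 2 = q + 1 := by rw [hq]; ring
    rw [this, Real.rpow_add hNpos, Real.rpow_one]
    ring
  rw [e]
  have hw : 0 ≤ (N * c) ^ q := by positivity
  refine mul_le_mul_of_nonneg_left (mul_le_mul_of_nonneg_left ?_ hw) (by positivity)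
  nlinarith
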